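/- Let Γ be a finite simple graph and g a non-trivial element of A(Γ). Write g = h w h⁻¹ where w is represented by a cyclically graphically reduced word, let supp(w) ⊆ Γ be the support of w, decompose supp(w) as a join Λ₁ ∗ ⋯ ∗ Λ_k of irreducible induced subgraphs, and write w = w₁ ⋯ w_k with w_i ∈ ⟨Λ_i⟩ for each i. For each i, let g_i be a generator of the maximal infinite cyclic subgroup of ⟨Λ_i⟩ containing w_i. Then the centralizer of g in A(Γ) equals h (⟨g₁⟩ × ⋯ × ⟨g_k⟩ × ⟨link(supp(w))⟩) h⁻¹, where the factors generate their internal direct product. -/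

import Mathlib

open Relation

universe u

/-- The defining relators of the right-angled Artin group of a simple graph. -/
def raagRels {V : Type u} (Γ : SimpleGraph V) : Set (FreeGroup V) :=
  {r | ∃ u v : V, Γ.Adj u v ∧
    r = FreeGroup.of u * FreeGroup.of v * (FreeGroup.of u)⁻¹ * (FreeGroup.of v)⁻¹}

/-- The right-angled Artin group of a simple graph. -/
abbrev RAAG {V : Type u} (Γ : SimpleGraph V) : Type u := PresentedGroup (raagRels Γ)

/-- The generator of `RAAG Γ` corresponding to a vertex. -/
def raagGen {V : Type u} (Γ : SimpleGraph V) (u : V) : RAAG Γ :=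
  PresentedGroup.of (rels := raagRels Γ) u

/-- The element of `RAAG Γ` represented by a word over `V(Γ) ⊔ V(Γ)⁻¹`. -/
def wordProd {V : Type u} (Γ : SimpleGraph V) (w : List (V × Bool)) : RAAG Γ :=
  (w.map fun p => if p.2 then raagGen Γ p.1 else (raagGen Γ p.1)⁻¹).prod

/-- A shuffling swaps two consecutive letters whose vertices are adjacent. -/
def Shuffle {V : Type u} (Γ : SimpleGraph V) (w w' : List (V × Bool)) : Prop :=
  ∃ (l₁ l₂ : List (V × Bool)) (a b : V × Bool),
    Γ.Adj a.1 b.1 ∧ w = l₁ ++ a :: b :: l₂ ∧ w' = l₁ ++ b :: a :: l₂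

/-- A free reduction deletes a consecutive pair of letters `u^ε u^(-ε)`. -/
def FreeRed {V : Type u} (_Γ : SimpleGraph V) (w w' : List (V × Bool)) : Prop :=
  ∃ (l₁ l₂ : List (V × Bool)) (u : V) (b : Bool),
    w = l₁ ++ (u, b) :: (u, !b) :: l₂ ∧ w' = l₁ ++ l₂

/-- A word is graphically reduced if it cannot be shortened by finitely many
shufflings and free reductions. -/
def GraphReduced {V : Type u} (Γ : SimpleGraph V) (w : List (V × Bool)) : Prop :=
  ¬ ∃ w' : List (V × Bool),
    ReflTransGen (fun x y => Shuffle Γ x y ∨ FreeRed Γ x y) w w' ∧ w'.length < w.length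

/-- A word is cyclically graphically reduced if it is graphically reduced and no
letter `u^ε` can be shuffled to the beginning while `u^(-ε)` is shuffled to the
end of the word. -/
def CyclicallyReduced {V : Type u} (Γ : SimpleGraph V) (w : List (V × Bool)) : Prop :=
  GraphReduced Γ w ∧
    ¬ ∃ (u : V) (b : Bool) (m : List (V × Bool)),
      ReflTransGen (Shuffle Γ) w ((u, b) :: (m ++ [(u, !b)]))

/-- The link of a set of vertices: the vertices adjacent to every vertex of `S`. -/
def linkSet {V : Type u} (Γ : SimpleGraph V) (S : Set V) : Set V :=
  {v | ∀ u ∈ S, Γ.Adj v u}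

/-- The support of a word: the set of vertices occurring in it. -/
def wordSupp {V : Type u} (w : List (V × Bool)) : Set V :=
  {v | ∃ b : Bool, (v, b) ∈ w}

/-- `Λ : Fin k → Set V` is a join decomposition of `S` in `Γ`: the `Λ i` are
non-empty, pairwise disjoint, partition `S`, and any two vertices in distinct
parts are adjacent. -/
def IsJoinDecomp {V : Type u} (Γ : SimpleGraph V) (S : Set V) {k : ℕ}
    (Λ : Fin k → Set V) : Prop :=
  (∀ i, (Λ i).Nonempty) ∧ (⋃ i, Λ i) = S ∧
    (∀ i j, i ≠ j → Disjoint (Λ i) (Λ j)) ∧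
    ∀ i j, i ≠ j → ∀ u ∈ Λ i, ∀ v ∈ Λ j, Γ.Adj u v

/-- A set of vertices is irreducible if it admits no non-trivial join decomposition. -/
def IrreducibleSet {V : Type u} (Γ : SimpleGraph V) (S : Set V) : Prop :=
  ¬ ∃ A B : Set V, A.Nonempty ∧ B.Nonempty ∧ Disjoint A B ∧ A ∪ B = S ∧
    ∀ u ∈ A, ∀ v ∈ B, Γ.Adj u v

namespace RightAngledArtin

variable {V : Type u} {Γ : SimpleGraph V}

/-! ### Words up to shuffling, through their projections to pairs of letters -/

open Classical in
/-- The subword of `l` formed by the occurrences of the letters `a` and `b`. -/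
noncomputable def pairProj (a b : V × Bool) (l : List (V × Bool)) : List (V × Bool) :=
  l.filter fun c => c = a ∨ c = b

/-- Two words are trace equivalent if they have the same projection to every pair of letters
with non-adjacent vertices. -/
def TraceEq (Γ : SimpleGraph V) (l m : List (V × Bool)) : Prop :=
  ∀ a b : V × Bool, ¬ Γ.Adj a.1 b.1 → pairProj a b l = pairProj a b m

@[simp] lemma pairProj_append (a b : V × Bool) (l m : List (V × Bool)) :
    pairProj a b (l ++ m) = pairProj a b l ++ pairProj a b m := by
  simp [pairProj]

open Classical in
lemma count_pairProj_left (a b : V × Bool) (l : List (V × Bool)) :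
    (pairProj a b l).count a = l.count a :=
  List.count_filter (by simp)

open Classical in
lemma count_pairProj_right (a b : V × Bool) (l : List (V × Bool)) :
    (pairProj a b l).count b = l.count b :=
  List.count_filter (by simp)

namespace TraceEq

variable {l m n l' m' : List (V × Bool)} {a b : V × Bool}

lemma refl (l : List (V × Bool)) : TraceEq Γ l l := fun _ _ _ => rfl

lemma symm (h : TraceEq Γ l m) : TraceEq Γ m l := fun a b hab => (h a b hab).symm

lemma trans (h : TraceEq Γ l m) (h' : TraceEq Γ m n) : TraceEq Γ l n :=
  fun a b hab => (h a b hab).trans (h' a b hab)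

lemma append (h : TraceEq Γ l m) (h' : TraceEq Γ l' m') : TraceEq Γ (l ++ l') (m ++ m') :=
  fun a b hab => by rw [pairProj_append, pairProj_append, h a b hab, h' a b hab]

lemma cons (a : V × Bool) (h : TraceEq Γ l m) : TraceEq Γ (a :: l) (a :: m) :=
  append (refl [a]) h

lemma of_append_left (h : TraceEq Γ (n ++ l) (n ++ m)) : TraceEq Γ l m := fun a b hab => by
  have := h a b hab
  rwa [pairProj_append, pairProj_append, List.append_cancel_left_eq] at this

lemma of_cons (h : TraceEq Γ (a :: l) (a :: m)) : TraceEq Γ l m :=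
  of_append_left (n := [a]) h

open Classical in
lemma perm (h : TraceEq Γ l m) : l.Perm m := by
  rw [List.perm_iff_count]
  intro a
  rw [← count_pairProj_left a a l, h a a (Γ.loopless.irrefl _), count_pairProj_left]

lemma swap (hab : Γ.Adj a.1 b.1) (l : List (V × Bool)) :
    TraceEq Γ (a :: b :: l) (b :: a :: l) := by
  intro c d hcd
  have : ¬ ((a = c ∨ a = d) ∧ (b = c ∨ b = d)) := by
    rintro ⟨rfl | rfl, rfl | rfl⟩
    · exact Γ.loopless.irrefl _ hab
    · exact hcd hab
    · exact hcd hab.symm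
    · exact Γ.loopless.irrefl _ hab
  by_cases h1 : (a = c ∨ a = d) <;> by_cases h2 : (b = c ∨ b = d) <;>
    simp_all [pairProj]

lemma move (p s : List (V × Bool)) (hp : ∀ c ∈ p, Γ.Adj a.1 c.1) :
    TraceEq Γ (a :: (p ++ s)) (p ++ a :: s) := by
  induction p with
  | nil => exact refl _
  | cons c p ih =>
    exact (swap (hp c (by simp)) _).trans (cons c (ih fun d hd => hp d (by simp [hd])))

/-- If a word is equivalent to `m` and starts with `a`, then `a` can be shuffled to the
beginning of `m`. -/
lemma exists_split (h : TraceEq Γ (a :: l) m) :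
    ∃ p s, m = p ++ a :: s ∧ (∀ c ∈ p, Γ.Adj a.1 c.1) ∧ TraceEq Γ l (p ++ s) := by
  obtain ⟨p, s, rfl, hap⟩ := List.eq_append_cons_of_mem (h.perm.mem_iff.1 List.mem_cons_self)
  have hp : ∀ c ∈ p, Γ.Adj a.1 c.1 := by
    intro c hc
    by_contra hac
    have h1 := h a c hac
    have h2 : pairProj a c (a :: l) = a :: pairProj a c l := by simp [pairProj]
    rw [h2, pairProj_append] at h1
    have hc' : c ∈ pairProj a c p := by simp [pairProj, hc]
    have ha' : a ∉ pairProj a c p := by simp [pairProj, hap]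
    cases hq : pairProj a c p with
    | nil => simp [hq] at hc'
    | cons d q =>
      rw [hq, List.cons_append, List.cons.injEq] at h1
      exact ha' (by rw [hq, h1.1]; exact List.mem_cons_self)
  exact ⟨p, s, rfl, hp, of_cons (h.trans (move p s hp).symm)⟩

/-- Levi's lemma for two first letters. -/
lemma levi_cons (h : TraceEq Γ (a :: l) (b :: m)) (hab : a ≠ b) :
    Γ.Adj a.1 b.1 ∧ ∃ z, TraceEq Γ l (b :: z) ∧ TraceEq Γ m (a :: z) := by
  obtain ⟨p, s, hm, hp, hl⟩ := h.exists_split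
  cases p with
  | nil => simp only [List.nil_append, List.cons.injEq] at hm; exact absurd hm.1.symm hab
  | cons c p =>
    obtain ⟨rfl, rfl⟩ : b = c ∧ m = p ++ a :: s := by simpa using hm
    exact ⟨hp b (by simp), p ++ s, hl, (move p s fun d hd => hp d (by simp [hd])).symm⟩

/-- Levi's lemma for the first letter of a product. -/
lemma levi_append (h : TraceEq Γ (a :: n) (l ++ m)) :
    (∃ z, TraceEq Γ l (a :: z)) ∨ ((∀ d ∈ l, Γ.Adj a.1 d.1) ∧ ∃ z, TraceEq Γ m (a :: z)) := by
  obtain ⟨p, s, hm, hp, -⟩ := h.exists_split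
  rcases List.append_eq_append_iff.1 hm with ⟨q, rfl, rfl⟩ | ⟨q, rfl, hq⟩
  · exact .inr ⟨fun d hd => hp d (by simp [hd]), q ++ s,
      (move q s fun d hd => hp d (by simp [hd])).symm⟩
  · cases q with
    | nil =>
      refine .inr ⟨fun d hd => hp d (by simpa using hd), s, ?_⟩
      rw [List.nil_append] at hq
      rw [← hq]
      exact refl _
    | cons c q =>
      obtain ⟨rfl, -⟩ : a = c ∧ s = q ++ m := by simpa using hq
      exact .inl ⟨p ++ q, (move p q hp).symm⟩

lemma shuffle (h : TraceEq Γ l m) : ReflTransGen (Shuffle Γ) l m := by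
  induction l generalizing m with
  | nil => rw [List.nil_perm.1 h.perm]
  | cons a l ih =>
    obtain ⟨p, s, rfl, hp, hl⟩ := h.exists_split
    have key : ∀ x y c, ReflTransGen (Shuffle Γ) x y →
        ReflTransGen (Shuffle Γ) (c :: x) (c :: y) := by
      intro x y c hxy
      refine hxy.lift (c :: ·) ?_
      rintro _ _ ⟨l₁, l₂, u, v, huv, rfl, rfl⟩
      exact ⟨c :: l₁, l₂, u, v, huv, rfl, rfl⟩
    refine (key _ _ a (ih hl)).trans ?_
    clear ih hl h
    induction p with
    | nil => exact .refl
    | cons c p ihp =>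
      refine ReflTransGen.head ?_ (key _ _ c (ihp fun d hd => hp d (by simp [hd])))
      exact ⟨[], p ++ s, a, c, hp c (by simp), rfl, rfl⟩

end TraceEq

/-! ### Products of words -/

/-- The inverse of a letter. -/
def letterInv (a : V × Bool) : V × Bool := (a.1, !a.2)

@[simp] lemma letterInv_fst (a : V × Bool) : (letterInv a).1 = a.1 := rfl

@[simp] lemma letterInv_letterInv (a : V × Bool) : letterInv (letterInv a) = a := by
  simp [letterInv]

lemma letterInv_ne (a : V × Bool) : letterInv a ≠ a := by
  rintro h
  have := congrArg Prod.snd h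
  simp [letterInv] at this

@[simp] lemma wordProd_nil : wordProd Γ [] = 1 := rfl

@[simp] lemma wordProd_append (l m : List (V × Bool)) :
    wordProd Γ (l ++ m) = wordProd Γ l * wordProd Γ m := by
  simp [wordProd]

lemma wordProd_cons (a : V × Bool) (l : List (V × Bool)) :
    wordProd Γ (a :: l) = wordProd Γ [a] * wordProd Γ l :=
  wordProd_append [a] l

lemma wordProd_letterInv (a : V × Bool) : wordProd Γ [letterInv a] = (wordProd Γ [a])⁻¹ := by
  obtain ⟨v, b⟩ := a
  cases b <;> simp [wordProd, letterInv]

lemma commute_raagGen {u v : V} (h : Γ.Adj u v) : Commute (raagGen Γ u) (raagGen Γ v) := by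
  have h1 : (PresentedGroup.mk (raagRels Γ)) (FreeGroup.of u * FreeGroup.of v *
      (FreeGroup.of u)⁻¹ * (FreeGroup.of v)⁻¹) = 1 :=
    PresentedGroup.one_of_mem ⟨u, v, h, rfl⟩
  simp only [map_mul, map_inv] at h1
  rw [mul_inv_eq_one, mul_inv_eq_iff_eq_mul] at h1
  exact h1

lemma wordProd_swap {a b : V × Bool} (h : Γ.Adj a.1 b.1) :
    Commute (wordProd Γ [a]) (wordProd Γ [b]) := by
  have := commute_raagGen h
  obtain ⟨u, c⟩ := a
  obtain ⟨v, d⟩ := b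
  cases c <;> cases d <;> simpa [wordProd] using this

lemma TraceEq.wordProd_eq {l m : List (V × Bool)} (h : TraceEq Γ l m) :
    wordProd Γ l = wordProd Γ m := by
  have hs := h.shuffle
  clear h
  induction hs with
  | refl => rfl
  | tail _ hs ih =>
    obtain ⟨l₁, l₂, a, b, hab, rfl, rfl⟩ := hs
    rw [ih, wordProd_append, wordProd_append, wordProd_cons a (b :: l₂), wordProd_cons b l₂,
      wordProd_cons b (a :: l₂), wordProd_cons a l₂, (wordProd_swap hab).left_comm]

lemma exists_wordProd_eq (x : RAAG Γ) : ∃ l, wordProd Γ l = x := by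
  have hx : x ∈ Subgroup.closure (Set.range (PresentedGroup.of (rels := raagRels Γ))) := by
    rw [PresentedGroup.closure_range_of]; trivial
  induction hx using Subgroup.closure_induction'' with
  | one => exact ⟨[], rfl⟩
  | mem x hx =>
    obtain ⟨v, rfl⟩ := hx
    exact ⟨[(v, true)], by simp [wordProd, raagGen]⟩
  | inv_mem x hx =>
    obtain ⟨v, rfl⟩ := hx
    exact ⟨[(v, false)], by simp [wordProd, raagGen]⟩
  | mul x y _ _ hx hy =>
    obtain ⟨l, rfl⟩ := hx
    obtain ⟨m, rfl⟩ := hy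
    exact ⟨l ++ m, wordProd_append l m⟩

/-! ### Reduced words and the normal form theorem -/

/-- A word is reduced if it is not trace equivalent to a word containing a cancelling pair. -/
def Reduced (Γ : SimpleGraph V) (l : List (V × Bool)) : Prop :=
  ∀ p a q, ¬ TraceEq Γ l (p ++ a :: letterInv a :: q)

lemma Reduced.congr {l m : List (V × Bool)} (hl : Reduced Γ l) (h : TraceEq Γ l m) :
    Reduced Γ m := fun p a q hm => hl p a q (h.trans hm)

lemma Reduced.of_cons {a : V × Bool} {l : List (V × Bool)} (h : Reduced Γ (a :: l)) :
    Reduced Γ l := fun p b q hl => h (a :: p) b q (hl.cons a)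

lemma reduced_nil : Reduced Γ [] := fun p a q h => by simpa using h.perm

/-- Prepending a letter which does not cancel keeps a word reduced. -/
lemma Reduced.cons {a : V × Bool} {l : List (V × Bool)} (hl : Reduced Γ l)
    (ha : ∀ z, ¬ TraceEq Γ l (letterInv a :: z)) : Reduced Γ (a :: l) := by
  intro p b q h
  induction p generalizing l with
  | nil =>
    by_cases hab : a = b
    · subst hab
      exact ha q h.of_cons
    · obtain ⟨hadj, z, hlz, hz⟩ := h.levi_cons hab
      have hne : a ≠ letterInv b := fun h => by simp [h] at hadj
      obtain ⟨-, z', -, hz'⟩ := hz.levi_cons hne.symm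
      exact hl [] b z' (hlz.trans (hz'.cons b))
  | cons c p ih =>
    by_cases hac : a = c
    · subst hac
      exact hl p b q h.of_cons
    · obtain ⟨hadj, z, hlz, hz⟩ := h.levi_cons hac
      refine ih (hl.congr hlz).of_cons (fun z' hz' => ?_) hz.symm
      exact ha (c :: z') (hlz.trans ((hz'.cons c).trans (.swap (by simpa using hadj.symm) z')))

open Classical in
/-- Multiplication of a reduced word by a letter, cancelling if possible. -/
noncomputable def mulLetter (Γ : SimpleGraph V) (a : V × Bool) (l : List (V × Bool)) :
    List (V × Bool) :=
  if h : ∃ z, TraceEq Γ l (letterInv a :: z) then h.choose else a :: l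

lemma mulLetter_of_cancel {a : V × Bool} {l z : List (V × Bool)}
    (h : TraceEq Γ l (letterInv a :: z)) : TraceEq Γ (mulLetter Γ a l) z := by
  have hex : ∃ z, TraceEq Γ l (letterInv a :: z) := ⟨z, h⟩
  rw [mulLetter, dif_pos hex]
  exact (hex.choose_spec.symm.trans h).of_cons

lemma mulLetter_of_not_cancel {a : V × Bool} {l : List (V × Bool)}
    (h : ∀ z, ¬ TraceEq Γ l (letterInv a :: z)) : mulLetter Γ a l = a :: l :=
  dif_neg (by simpa using h)

lemma mulLetter_congr (a : V × Bool) {l m : List (V × Bool)} (h : TraceEq Γ l m) :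
    TraceEq Γ (mulLetter Γ a l) (mulLetter Γ a m) := by
  by_cases hl : ∃ z, TraceEq Γ l (letterInv a :: z)
  · obtain ⟨z, hz⟩ := hl
    exact (mulLetter_of_cancel hz).trans (mulLetter_of_cancel (h.symm.trans hz)).symm
  · push Not at hl
    rw [mulLetter_of_not_cancel hl, mulLetter_of_not_cancel fun z hz => hl z (h.trans hz)]
    exact h.cons a

lemma Reduced.mulLetter (a : V × Bool) {l : List (V × Bool)} (hl : Reduced Γ l) :
    Reduced Γ (mulLetter Γ a l) := by
  by_cases h : ∃ z, TraceEq Γ l (letterInv a :: z)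
  · obtain ⟨z, hz⟩ := h
    exact (hl.congr hz).of_cons.congr (mulLetter_of_cancel hz).symm
  · push Not at h
    rw [mulLetter_of_not_cancel h]
    exact hl.cons h

lemma mulLetter_letterInv (a : V × Bool) {l : List (V × Bool)} (hl : Reduced Γ l) :
    TraceEq Γ (mulLetter Γ (letterInv a) (mulLetter Γ a l)) l := by
  by_cases h : ∃ z, TraceEq Γ l (letterInv a :: z)
  · obtain ⟨z, hz⟩ := h
    refine (mulLetter_congr _ (mulLetter_of_cancel hz)).trans ?_
    rw [mulLetter_of_not_cancel]
    · exact hz.symm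
    · intro y hy
      exact hl [] (letterInv a) y (hz.trans (hy.cons _))
  · push Not at h
    rw [mulLetter_of_not_cancel h]
    exact mulLetter_of_cancel (by rw [letterInv_letterInv]; exact .refl _)

lemma mulLetter_comm {a b : V × Bool} (hab : Γ.Adj a.1 b.1) (l : List (V × Bool)) :
    TraceEq Γ (mulLetter Γ a (mulLetter Γ b l)) (mulLetter Γ b (mulLetter Γ a l)) := by
  have key : ∀ {a b : V × Bool}, Γ.Adj a.1 b.1 → (∃ z, TraceEq Γ l (letterInv a :: z)) →
      TraceEq Γ (mulLetter Γ a (mulLetter Γ b l)) (mulLetter Γ b (mulLetter Γ a l)) := by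
    rintro a b hab ⟨z, hz⟩
    have hne : letterInv a ≠ letterInv b := fun h => by
      have := congrArg Prod.fst h
      simp only [letterInv_fst] at this
      simp [this] at hab
    have hne' : letterInv a ≠ b := fun h => by
      have := congrArg Prod.fst h
      simp only [letterInv_fst] at this
      simp [this] at hab
    refine .trans ?_ (mulLetter_congr b (mulLetter_of_cancel hz)).symm
    by_cases hb : ∃ y, TraceEq Γ l (letterInv b :: y)
    · obtain ⟨y, hy⟩ := hb
      obtain ⟨-, t, hzt, hyt⟩ := (hz.symm.trans hy).levi_cons hne
      exact (mulLetter_congr a (mulLetter_of_cancel hy)).trans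
        ((mulLetter_of_cancel hyt).trans (mulLetter_of_cancel hzt).symm)
    · push Not at hb
      rw [mulLetter_of_not_cancel hb, mulLetter_of_not_cancel (l := z)]
      · refine mulLetter_of_cancel ((hz.cons b).trans (.swap ?_ z))
        simpa using hab.symm
      · intro y hy
        exact hb (letterInv a :: y) (hz.trans ((hy.cons _).trans (.swap (by simpa using hab) y)))
  by_cases ha : ∃ z, TraceEq Γ l (letterInv a :: z)
  · exact key hab ha
  by_cases hb : ∃ z, TraceEq Γ l (letterInv b :: z)
  · exact (key hab.symm hb).symm
  push Not at ha hb
  have hcons : ∀ {a b : V × Bool}, Γ.Adj a.1 b.1 → (∀ z, ¬ TraceEq Γ l (letterInv a :: z)) →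
      ∀ z, ¬ TraceEq Γ (b :: l) (letterInv a :: z) := by
    intro a b hab ha z hz
    obtain ⟨-, t, ht, -⟩ := hz.levi_cons fun h => by simp [h] at hab
    exact ha t ht
  rw [mulLetter_of_not_cancel ha, mulLetter_of_not_cancel hb,
    mulLetter_of_not_cancel (hcons hab ha), mulLetter_of_not_cancel (hcons hab.symm hb)]
  exact .swap hab l

/-- Trace equivalence of reduced words. -/
def reducedSetoid (Γ : SimpleGraph V) : Setoid {l : List (V × Bool) // Reduced Γ l} where
  r l m := TraceEq Γ l.1 m.1
  iseqv := ⟨fun l => .refl l.1, fun h => h.symm, fun h h' => h.trans h'⟩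

/-- The set of reduced words up to trace equivalence. -/
abbrev ReducedTrace (Γ : SimpleGraph V) := Quotient (reducedSetoid Γ)

/-- The action of a letter on reduced traces. -/
noncomputable def letterAct (Γ : SimpleGraph V) (a : V × Bool) :
    ReducedTrace Γ → ReducedTrace Γ :=
  Quotient.map (fun l => ⟨mulLetter Γ a l.1, l.2.mulLetter a⟩) fun _ _ h => mulLetter_congr a h

lemma letterAct_letterInv (a : V × Bool) (x : ReducedTrace Γ) :
    letterAct Γ (letterInv a) (letterAct Γ a x) = x := by
  induction x using Quotient.inductionOn with
  | h l => exact Quotient.sound (mulLetter_letterInv a l.2)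

/-- The action of a generator on reduced traces, as a permutation. -/
noncomputable def genPerm (Γ : SimpleGraph V) (v : V) : Equiv.Perm (ReducedTrace Γ) where
  toFun := letterAct Γ (v, true)
  invFun := letterAct Γ (v, false)
  left_inv := letterAct_letterInv (v, true)
  right_inv := letterAct_letterInv (v, false)

/-- The action of the right-angled Artin group on reduced traces. -/
noncomputable def traceAction (Γ : SimpleGraph V) : RAAG Γ →* Equiv.Perm (ReducedTrace Γ) :=
  PresentedGroup.toGroup (f := genPerm Γ) <| by
    rintro _ ⟨u, v, huv, rfl⟩
    simp only [map_mul, map_inv, FreeGroup.lift_apply_of]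
    rw [mul_inv_eq_one, mul_inv_eq_iff_eq_mul]
    ext x
    induction x using Quotient.inductionOn with
    | h l => exact Quotient.sound (mulLetter_comm (a := (u, true)) (b := (v, true)) huv l.1)

lemma traceAction_letter (a : V × Bool) (x : ReducedTrace Γ) :
    traceAction Γ (wordProd Γ [a]) x = letterAct Γ a x := by
  obtain ⟨v, b⟩ := a
  have h : traceAction Γ (raagGen Γ v) = genPerm Γ v := PresentedGroup.toGroup.of _
  cases b
  · simp only [wordProd, List.map_cons, List.map_nil, List.prod_singleton, map_inv, h,
      Bool.false_eq_true, if_false]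
    rfl
  · simp only [wordProd, List.map_cons, List.map_nil, List.prod_singleton, h, if_true]
    rfl

lemma traceAction_wordProd {l : List (V × Bool)} (hl : Reduced Γ l) :
    traceAction Γ (wordProd Γ l) (Quotient.mk _ ⟨[], reduced_nil⟩) = Quotient.mk _ ⟨l, hl⟩ := by
  induction l with
  | nil => simp
  | cons a l ih =>
    rw [wordProd_cons, map_mul, Equiv.Perm.mul_apply, ih hl.of_cons, traceAction_letter]
    refine Quotient.sound ?_
    change TraceEq Γ (mulLetter Γ a l) (a :: l)
    rw [mulLetter_of_not_cancel]
    · exact .refl _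
    · exact fun z hz => hl [] a z (hz.cons a)

/-- Reduced words representing the same element are trace equivalent. -/
theorem Reduced.traceEq {l m : List (V × Bool)} (hl : Reduced Γ l) (hm : Reduced Γ m)
    (h : wordProd Γ l = wordProd Γ m) : TraceEq Γ l m := by
  have := traceAction_wordProd hl
  rw [h, traceAction_wordProd hm] at this
  exact TraceEq.symm (Quotient.exact this)

lemma exists_shorter_of_not_reduced {l : List (V × Bool)} (hl : ¬ Reduced Γ l) :
    ∃ m, wordProd Γ m = wordProd Γ l ∧ m.length < l.length := by
  simp only [Reduced, not_forall, not_not] at hl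
  obtain ⟨p, a, q, h⟩ := hl
  refine ⟨p ++ q, ?_, ?_⟩
  · rw [h.wordProd_eq, wordProd_append, wordProd_append, wordProd_cons, wordProd_cons _ q,
      wordProd_letterInv, mul_inv_cancel_left]
  · rw [h.perm.length_eq]
    simp

lemma exists_reduced (l : List (V × Bool)) :
    ∃ m, Reduced Γ m ∧ wordProd Γ m = wordProd Γ l ∧ m.length ≤ l.length := by
  induction hn : l.length using Nat.strong_induction_on generalizing l with
  | h n ih =>
    subst hn
    by_cases hl : Reduced Γ l
    · exact ⟨l, hl, rfl, le_rfl⟩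
    · obtain ⟨m, hm, hlt⟩ := exists_shorter_of_not_reduced hl
      obtain ⟨r, hr, hrm, hle⟩ := ih _ hlt m rfl
      exact ⟨r, hr, hrm.trans hm, hle.trans hlt.le⟩

lemma Reduced.length_le {l m : List (V × Bool)} (hl : Reduced Γ l)
    (h : wordProd Γ m = wordProd Γ l) : l.length ≤ m.length := by
  obtain ⟨r, hr, hrm, hle⟩ := exists_reduced (Γ := Γ) m
  rwa [(hl.traceEq hr (h.symm.trans hrm.symm)).perm.length_eq]

lemma Reduced.of_length_le {l m : List (V × Bool)} (hl : Reduced Γ l)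
    (h : wordProd Γ m = wordProd Γ l) (hlen : m.length ≤ l.length) : Reduced Γ m := by
  by_contra hm
  obtain ⟨r, hr, hlt⟩ := exists_shorter_of_not_reduced hm
  have := hl.length_le (hr.trans h)
  omega

/-! ### Powers of cyclically reduced words -/

/-- The `n`-th power of a word. -/
def wordPow (n : ℕ) (w : List (V × Bool)) : List (V × Bool) :=
  (List.replicate n w).flatten

@[simp] lemma wordPow_zero (w : List (V × Bool)) : wordPow 0 w = [] := rfl

lemma wordPow_succ (n : ℕ) (w : List (V × Bool)) : wordPow (n + 1) w = w ++ wordPow n w := by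
  simp [wordPow, List.replicate_succ]

@[simp] lemma length_wordPow (n : ℕ) (w : List (V × Bool)) :
    (wordPow n w).length = n * w.length := by
  simp [wordPow]

open Classical in
lemma count_wordPow (n : ℕ) (w : List (V × Bool)) (a : V × Bool) :
    (wordPow n w).count a = n * w.count a := by
  induction n with
  | zero => simp
  | succ n ih => rw [wordPow_succ, List.count_append, ih]; ring

@[simp] lemma wordProd_wordPow (n : ℕ) (w : List (V × Bool)) :
    wordProd Γ (wordPow n w) = wordProd Γ w ^ n := by
  induction n with
  | zero => simp
  | succ n ih => rw [wordPow_succ, wordProd_append, ih, pow_succ']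

lemma mem_of_mem_wordPow {n : ℕ} {w : List (V × Bool)} {a : V × Bool} (h : a ∈ wordPow n w) :
    a ∈ w := by
  simp only [wordPow, List.mem_flatten, List.mem_replicate] at h
  obtain ⟨_, ⟨-, rfl⟩, h⟩ := h
  exact h

lemma TraceEq.wordPow_comm {x w : List (V × Bool)} (h : TraceEq Γ (x ++ w) (w ++ x)) (n : ℕ) :
    TraceEq Γ (wordPow n x ++ w) (w ++ wordPow n x) := by
  induction n with
  | zero => simpa using TraceEq.refl w
  | succ n ih =>
    rw [wordPow_succ, List.append_assoc, ← List.append_assoc w]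
    refine ((TraceEq.refl x).append ih).trans ?_
    rw [← List.append_assoc]
    exact h.append (.refl _)

/-- If a product of reduced words is not reduced, some last letter of the first factor cancels
with some first letter of the second factor. -/
lemma Reduced.append {x y : List (V × Bool)} (hx : Reduced Γ x) (hy : Reduced Γ y)
    (h : ∀ b p q, TraceEq Γ x (p ++ [b]) → ¬ TraceEq Γ y (letterInv b :: q)) :
    Reduced Γ (x ++ y) := by
  induction x with
  | nil => exact hy
  | cons a x ih =>
    have hxy : Reduced Γ (x ++ y) :=
      ih hx.of_cons fun b p q hp => h b (a :: p) q (hp.cons a)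
    refine hxy.cons fun z hz => ?_
    rcases hz.symm.levi_append with ⟨t, ht⟩ | ⟨hadj, t, ht⟩
    · exact hx [] a t (ht.cons a)
    · refine h a x t ?_ ht
      simpa using TraceEq.move x [] fun c hc => by simpa using hadj c hc

lemma reduced_of_graphReduced {w : List (V × Bool)} (hw : GraphReduced Γ w) : Reduced Γ w := by
  intro p a q h
  refine hw ⟨p ++ q, ?_, ?_⟩
  · exact ReflTransGen.tail (ReflTransGen.mono (fun _ _ => Or.inl) _ _ h.shuffle)
      (Or.inr ⟨p, q, a.1, a.2, rfl, rfl⟩)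
  · rw [h.perm.length_eq]
    simp

lemma reduced_wordPow {w : List (V × Bool)} (hw : CyclicallyReduced Γ w) (n : ℕ) :
    Reduced Γ (wordPow n w) := by
  have hred := reduced_of_graphReduced hw.1
  induction n with
  | zero => exact reduced_nil
  | succ n ih =>
    rw [wordPow_succ]
    refine hred.append ih fun b p q hp hq => ?_
    have hbw : b ∈ w := hp.perm.mem_iff.2 (by simp)
    have hfirst : ∃ z, TraceEq Γ w (letterInv b :: z) := by
      cases n with
      | zero => simpa using hq.perm
      | succ n =>
        rw [wordPow_succ] at hq
        rcases hq.symm.levi_append with hz | ⟨hadj, -⟩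
        · exact hz
        · exact absurd (hadj b hbw) (by simp)
    obtain ⟨z, hz⟩ := hfirst
    rcases (hz.symm.trans hp).levi_append with ⟨t, ht⟩ | ⟨-, t, ht⟩
    · refine hw.2 ⟨b.1, !b.2, t, ?_⟩
      have := (hp.trans (ht.append (.refl [b]))).shuffle
      simpa [letterInv] using this
    · have : letterInv b ∈ [b] := ht.perm.mem_iff.2 (by simp)
      exact letterInv_ne b (by simpa using this)

/-- An element commuting with a cyclically reduced word becomes, after multiplication by a
power of that word, a word commuting with it up to shuffling. -/
lemma exists_traceEq_comm {w : List (V × Bool)} (hw : CyclicallyReduced Γ w) {x : RAAG Γ}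
    (hx : Commute x (wordProd Γ w)) :
    ∃ (n : ℕ) (X : List (V × Bool)), wordProd Γ X = x * wordProd Γ w ^ n ∧
      TraceEq Γ (X ++ w) (w ++ X) := by
  have hex : ∀ y : RAAG Γ, ∃ l, Reduced Γ l ∧ wordProd Γ l = y := by
    intro y
    obtain ⟨l, rfl⟩ := exists_wordProd_eq y
    obtain ⟨m, hm, hml, -⟩ := exists_reduced (Γ := Γ) l
    exact ⟨m, hm, hml⟩
  choose X hXred hX using fun n : ℕ => hex (x * wordProd Γ w ^ n)
  obtain ⟨Y, -, hY⟩ := hex x⁻¹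
  have hlow : ∀ n, n * w.length ≤ Y.length + (X n).length := by
    intro n
    have := (reduced_wordPow hw n).length_le (m := Y ++ X n) (by simp [hX, hY])
    simpa using this
  obtain ⟨n, hn⟩ : ∃ n, (X n).length + w.length ≤ (X (n + 1)).length := by
    by_contra! hlt
    have hup : ∀ n, (X n).length + n ≤ (X 0).length + n * w.length := by
      intro n
      induction n with
      | zero => simp
      | succ n ih =>
        have := hlt n
        rw [add_mul]
        omega
    have h1 := hlow (Y.length + (X 0).length + 1)
    have h2 := hup (Y.length + (X 0).length + 1)
    omega
  refine ⟨n, X n, hX n, ?_⟩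
  have h1 : wordProd Γ (X n ++ w) = wordProd Γ (X (n + 1)) := by
    rw [wordProd_append, hX, hX, pow_succ, mul_assoc]
  have h2 : wordProd Γ (w ++ X n) = wordProd Γ (X (n + 1)) := by
    rw [wordProd_append, hX, hX, pow_succ', ← mul_assoc, ← mul_assoc, hx.eq]
  exact ((hXred _).of_length_le h1 (by simpa using hn)).traceEq
    ((hXred _).of_length_le h2 (by simpa [add_comm] using hn)) (h1.trans h2.symm)

/-! ### Commuting words -/

/-- Two words of the same length commuting with a common non-empty word are equal. -/
lemma eq_of_append_comm {u v w : List (V × Bool)} (hw : w ≠ []) (hu : u ++ w = w ++ u)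
    (hv : v ++ w = w ++ v) (hlen : u.length = v.length) : u = v := by
  have hpow : ∀ (y : List (V × Bool)), y ++ w = w ++ y →
      ∀ n, y ++ wordPow n w = wordPow n w ++ y := by
    intro y hy n
    induction n with
    | zero => simp
    | succ n ih =>
      rw [wordPow_succ, ← List.append_assoc, hy, List.append_assoc, ih, List.append_assoc]
  have hprefix : ∀ (y : List (V × Bool)), y ++ w = w ++ y → y.length = u.length →
      y = (wordPow u.length w).take u.length := by
    intro y hy hyu
    have hle : u.length ≤ (wordPow u.length w).length := by
      rw [length_wordPow]
      exact Nat.le_mul_of_pos_right _ (List.length_pos_iff.2 hw)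
    have := congrArg (List.take u.length) (hpow y hy u.length)
    rwa [List.take_append_of_le_length hle, ← hyu, List.take_left, hyu] at this
  rw [hprefix u hu rfl, ← hprefix v hv hlen.symm]

open Classical in
lemma count_mul_length_of_append_comm {u w : List (V × Bool)} (h : u ++ w = w ++ u)
    (a : V × Bool) : w.length * u.count a = u.length * w.count a := by
  by_cases hw : w = []
  · simp [hw]
  have hpow : ∀ (y : List (V × Bool)), y ++ w = w ++ y →
      ∀ n, wordPow n y ++ w = w ++ wordPow n y := by
    intro y hy n
    induction n with
    | zero => simp
    | succ n ih =>
      rw [wordPow_succ, List.append_assoc, ih, ← List.append_assoc, hy, List.append_assoc]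
  have := eq_of_append_comm hw (hpow u h w.length) (hpow w rfl u.length)
    (by simp [mul_comm])
  rw [← count_wordPow, this, count_wordPow]

open Classical in
/-- Commuting words have proportional numbers of occurrences of two non-adjacent letters. -/
lemma TraceEq.count_mul_count {x w : List (V × Bool)} (h : TraceEq Γ (x ++ w) (w ++ x))
    {a b : V × Bool} (hab : ¬ Γ.Adj a.1 b.1) :
    x.count a * w.count b = x.count b * w.count a := by
  have hc := h a b hab
  rw [pairProj_append, pairProj_append] at hc
  have ha := count_mul_length_of_append_comm hc a
  have hb := count_mul_length_of_append_comm hc b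
  rw [count_pairProj_left, count_pairProj_left] at ha
  rw [count_pairProj_right, count_pairProj_right] at hb
  by_cases hw : pairProj a b w = []
  · rw [← count_pairProj_left a b w, ← count_pairProj_right a b w, hw]
    simp
  · apply Nat.eq_of_mul_eq_mul_left (List.length_pos_iff.2 hw)
    rw [← mul_assoc, ha, ← mul_assoc, hb]
    ring

open Classical in
/-- Every letter of a word commuting with `w` occurs in `w` or lies in the link of `w`. -/
lemma TraceEq.mem_supp_or_mem_link {x w : List (V × Bool)} (h : TraceEq Γ (x ++ w) (w ++ x))
    {a : V × Bool} (ha : a ∈ x) : a.1 ∈ wordSupp w ∪ linkSet Γ (wordSupp w) := by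
  by_contra hcon
  simp only [Set.mem_union, not_or, linkSet, Set.mem_ofPred_eq, not_forall] at hcon
  obtain ⟨haw, s, ⟨c, hs⟩, has⟩ := hcon
  have hcount := h.count_mul_count (a := a) (b := (s, c)) has
  have h1 : w.count a = 0 := List.count_eq_zero.2 fun haw' => haw ⟨a.2, haw'⟩
  have h2 := List.count_pos_iff.2 ha
  have h3 := List.count_pos_iff.2 hs
  rw [h1, mul_zero] at hcount
  exact (Nat.mul_pos h2 h3).ne' hcount

open Classical in
/-- For irreducible support, commuting words have proportional letter counts. -/
lemma TraceEq.count_mul_count_of_irreducible {x w : List (V × Bool)}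
    (hirr : IrreducibleSet Γ (wordSupp w)) (hx : wordSupp x ⊆ wordSupp w)
    (h : TraceEq Γ (x ++ w) (w ++ x)) {e : V × Bool} (he : e ∈ w) (a : V × Bool) :
    x.count a * w.count e = x.count e * w.count a := by
  by_cases ha : a.1 ∈ wordSupp w
  swap
  · rw [List.count_eq_zero.2 fun h' => ha (hx ⟨a.2, h'⟩),
      List.count_eq_zero.2 fun h' => ha ⟨a.2, h'⟩, zero_mul, mul_zero]
  let A : Set V := {v ∈ wordSupp w | ∀ c, x.count (v, c) * w.count e = x.count e * w.count (v, c)}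
  have heA : e.1 ∈ A := ⟨⟨e.2, he⟩, fun c => h.count_mul_count (Γ.loopless.irrefl _)⟩
  have hjoin : ∀ u ∈ A, ∀ v ∈ wordSupp w \ A, Γ.Adj u v := by
    rintro u ⟨⟨c, huw⟩, hu⟩ v ⟨hv, hvA⟩
    by_contra huv
    refine hvA ⟨hv, fun d => ?_⟩
    have h1 := h.count_mul_count (a := (u, c)) (b := (v, d)) huv
    apply Nat.eq_of_mul_eq_mul_left (List.count_pos_iff.2 huw)
    linear_combination w.count (v, d) * hu c - w.count e * h1
  have haA : a.1 ∈ A := by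
    by_contra haA
    exact hirr ⟨A, wordSupp w \ A, ⟨_, heA⟩, ⟨_, ha, haA⟩, Set.disjoint_sdiff_right,
      Set.union_sdiff_cancel (Set.sep_subset _ _), hjoin⟩
  exact haA.2 a.2

open Classical in
/-- For irreducible support, a word commuting with `w` is determined by one letter count. -/
lemma TraceEq.of_comm_of_irreducible {x y w : List (V × Bool)}
    (hirr : IrreducibleSet Γ (wordSupp w)) (hx : wordSupp x ⊆ wordSupp w)
    (hy : wordSupp y ⊆ wordSupp w) (hxw : TraceEq Γ (x ++ w) (w ++ x))
    (hyw : TraceEq Γ (y ++ w) (w ++ y)) {e : V × Bool} (he : e ∈ w)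
    (hcount : x.count e = y.count e) : TraceEq Γ x y := by
  have hxy : x.Perm y := by
    rw [List.perm_iff_count]
    intro a
    apply Nat.eq_of_mul_eq_mul_right (List.count_pos_iff.2 he)
    rw [hxw.count_mul_count_of_irreducible hirr hx he, hcount,
      hyw.count_mul_count_of_irreducible hirr hy he]
  intro a b hab
  have h1 := hxw a b hab
  have h2 := hyw a b hab
  rw [pairProj_append, pairProj_append] at h1 h2
  by_cases hw : pairProj a b w = []
  · have hnil : ∀ z, wordSupp z ⊆ wordSupp w → TraceEq Γ (z ++ w) (w ++ z) →
        pairProj a b z = [] := by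
      intro z hz hzw
      have hnot : ∀ c, w.count c = 0 → c ∉ z := by
        intro c hc hcz
        have := hzw.count_mul_count_of_irreducible hirr hz he c
        rw [hc, mul_zero] at this
        exact (Nat.mul_pos (List.count_pos_iff.2 hcz) (List.count_pos_iff.2 he)).ne' this
      have ha := hnot a (by rw [← count_pairProj_left a b w, hw]; rfl)
      have hb := hnot b (by rw [← count_pairProj_right a b w, hw]; rfl)
      rw [pairProj, List.filter_eq_nil_iff]
      intro c hc hcab
      rcases of_decide_eq_true hcab with rfl | rfl
      · exact ha hc
      · exact hb hc
    rw [hnil x hx hxw, hnil y hy hyw]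
  · exact eq_of_append_comm hw h1 h2 (hxy.filter _).length_eq

lemma wordSupp_append (l m : List (V × Bool)) :
    wordSupp (l ++ m) = wordSupp l ∪ wordSupp m := by
  ext v
  simp [wordSupp, exists_or]

lemma wordSupp_wordPow_subset (n : ℕ) (w : List (V × Bool)) :
    wordSupp (wordPow n w) ⊆ wordSupp w :=
  fun _ ⟨b, hb⟩ => ⟨b, mem_of_mem_wordPow hb⟩

open Classical in
/-- A group of elements commuting with a word of irreducible support, each represented modulo
powers of the word by a word commuting with it, is cyclic as soon as it contains an element of
infinite order. -/
lemma isCyclic_of_irreducible {w : List (V × Bool)} (hirr : IrreducibleSet Γ (wordSupp w))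
    (hne : (wordSupp w).Nonempty) (C : Subgroup (RAAG Γ))
    (hcomm : ∀ x ∈ C, Commute x (wordProd Γ w))
    (hC : ∀ x ∈ C, ∃ (n : ℕ) (X : List (V × Bool)), wordSupp X ⊆ wordSupp w ∧
      wordProd Γ X = x * wordProd Γ w ^ n ∧ TraceEq Γ (X ++ w) (w ++ X))
    {g : RAAG Γ} (hg : g ∈ C) (hginf : ∀ n : ℕ, 0 < n → g ^ n ≠ 1)
    (hwg : wordProd Γ w ∈ Subgroup.zpowers g) : IsCyclic C := by
  obtain ⟨v, b, he⟩ := hne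
  set e : V × Bool := (v, b)
  set ω := wordProd Γ w
  have hepos : 0 < w.count e := List.count_pos_iff.2 he
  choose N X hXsupp hX hXw using fun x : C => hC x.1 x.2
  let φ : C → ℤ := fun x => (X x).count e - N x * w.count e
  have hself : ∀ n, TraceEq Γ (wordPow n w ++ w) (w ++ wordPow n w) :=
    fun n => TraceEq.wordPow_comm (.refl _) n
  have hφ : ∀ x : C, (x : RAAG Γ) ^ w.count e = ω ^ φ x := by
    intro x
    have h1 : TraceEq Γ (wordPow (w.count e) (X x)) (wordPow ((X x).count e) w) :=
      .of_comm_of_irreducible hirr ((wordSupp_wordPow_subset _ _).trans (hXsupp x))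
        (wordSupp_wordPow_subset _ _) ((hXw x).wordPow_comm _) (hself _) he
        (by rw [count_wordPow, count_wordPow, mul_comm])
    have h2 := h1.wordProd_eq
    rw [wordProd_wordPow, wordProd_wordPow, hX, ((hcomm x x.2).pow_right _).mul_pow, ← pow_mul]
      at h2
    rw [zpow_sub, eq_mul_inv_iff_mul_eq]
    exact_mod_cast h2
  have hφinj : Function.Injective φ := by
    intro x y hxy
    have h1 : TraceEq Γ (X x ++ wordPow (N y) w) (X y ++ wordPow (N x) w) := by
      have hcomm' : ∀ (z : C) n, TraceEq Γ ((X z ++ wordPow n w) ++ w)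
          (w ++ (X z ++ wordPow n w)) := by
        intro z n
        rw [List.append_assoc, ← List.append_assoc w]
        refine ((TraceEq.refl _).append (hself n)).trans ?_
        rw [← List.append_assoc]
        exact (hXw z).append (.refl _)
      have hsupp : ∀ (z : C) n, wordSupp (X z ++ wordPow n w) ⊆ wordSupp w := by
        intro z n
        rw [wordSupp_append]
        exact Set.union_subset (hXsupp z) (wordSupp_wordPow_subset _ _)
      refine .of_comm_of_irreducible hirr (hsupp _ _) (hsupp _ _) (hcomm' _ _) (hcomm' _ _) he ?_
      rw [List.count_append, List.count_append, count_wordPow, count_wordPow]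
      zify
      linear_combination hxy
    have h2 := h1.wordProd_eq
    rw [wordProd_append, wordProd_append, wordProd_wordPow, wordProd_wordPow, hX, hX, mul_assoc,
      mul_assoc, ← pow_add, ← pow_add, add_comm (N y), mul_left_inj] at h2
    exact Subtype.ext h2
  have hωinf : Function.Injective fun n : ℤ => ω ^ n := by
    have hgord : ¬ IsOfFinOrder g := by
      rw [isOfFinOrder_iff_pow_eq_one]
      rintro ⟨n, hn, hgn⟩
      exact hginf n hn hgn
    obtain ⟨t, ht⟩ := Subgroup.mem_zpowers_iff.1 hwg
    have ht0 : t ≠ 0 := by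
      rintro rfl
      rw [zpow_zero] at ht
      have := hφ ⟨g, hg⟩
      rw [← ht, one_zpow] at this
      exact hginf _ hepos this
    intro m n hmn
    simp only [← ht, ← zpow_mul] at hmn
    exact mul_left_cancel₀ ht0 (injective_zpow_iff_not_isOfFinOrder.2 hgord hmn)
  have hab : ∀ x y : C, x * y = y * x := by
    intro x y
    have h1 : φ (x * y * x⁻¹) = φ y := by
      apply hωinf
      change ω ^ _ = ω ^ _
      rw [← hφ, ← hφ, Subgroup.coe_mul, Subgroup.coe_mul, Subgroup.coe_inv, conj_pow, hφ,
        ((hcomm x x.2).zpow_right _).eq, mul_inv_cancel_right]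
    exact mul_inv_eq_iff_eq_mul.1 (hφinj h1)
  let Φ : C →* Multiplicative ℤ := MonoidHom.mk' (fun x => Multiplicative.ofAdd (φ x)) <| by
    intro x y
    rw [← ofAdd_add]
    congr 1
    apply hωinf
    change ω ^ _ = ω ^ _
    rw [← hφ, zpow_add, ← hφ, ← hφ, Subgroup.coe_mul, Commute.mul_pow]
    exact congrArg Subtype.val (hab x y)
  exact isCyclic_of_injective Φ fun x y h => hφinj (Multiplicative.ofAdd.injective h)

/-! ### Standard subgroups and retractions -/

/-- The subgroup generated by a set of vertices. -/
abbrev standardSubgroup (Γ : SimpleGraph V) (T : Set V) : Subgroup (RAAG Γ) :=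
  Subgroup.closure (raagGen Γ '' T)

lemma commute_of_adj {A B : Set V} (hAB : ∀ u ∈ A, ∀ v ∈ B, Γ.Adj u v) {x y : RAAG Γ}
    (hx : x ∈ standardSubgroup Γ A) (hy : y ∈ standardSubgroup Γ B) : Commute x y := by
  have hgen : ∀ u ∈ A, Commute (raagGen Γ u) y := by
    intro u hu
    induction hy using Subgroup.closure_induction with
    | mem y hy =>
      obtain ⟨v, hv, rfl⟩ := hy
      exact commute_raagGen (hAB u hu v hv)
    | one => exact Commute.one_right _
    | mul y z _ _ hy hz => exact hy.mul_right hz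
    | inv y _ hy => exact hy.inv_right
  induction hx using Subgroup.closure_induction with
  | mem x hx =>
    obtain ⟨u, hu, rfl⟩ := hx
    exact hgen u hu
  | one => exact Commute.one_left _
  | mul x z _ _ hx hz => exact hx.mul_left hz
  | inv x _ hx => exact hx.inv_left

open Classical in
/-- The retraction onto the subgroup generated by `T`, killing all other generators. -/
noncomputable def retraction (Γ : SimpleGraph V) (T : Set V) : RAAG Γ →* RAAG Γ :=
  PresentedGroup.toGroup (f := fun v => if v ∈ T then raagGen Γ v else 1) <| by
    rintro _ ⟨u, v, huv, rfl⟩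
    simp only [map_mul, map_inv, FreeGroup.lift_apply_of]
    rw [mul_inv_eq_one, mul_inv_eq_iff_eq_mul]
    by_cases hu : u ∈ T <;> by_cases hv : v ∈ T <;> simp [hu, hv, (commute_raagGen huv).eq]

open Classical in
lemma retraction_raagGen (T : Set V) (v : V) :
    retraction Γ T (raagGen Γ v) = if v ∈ T then raagGen Γ v else 1 :=
  PresentedGroup.toGroup.of _

lemma retraction_of_mem {T : Set V} {x : RAAG Γ} (hx : x ∈ standardSubgroup Γ T) :
    retraction Γ T x = x := by
  refine MonoidHom.eqOn_closure (f := retraction Γ T) (g := MonoidHom.id _) ?_ hx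
  rintro _ ⟨v, hv, rfl⟩
  simp [retraction_raagGen, hv]

lemma retraction_eq_one {T S : Set V} (hTS : Disjoint T S) {x : RAAG Γ}
    (hx : x ∈ standardSubgroup Γ S) : retraction Γ T x = 1 := by
  refine MonoidHom.eqOn_closure (f := retraction Γ T) (g := 1) ?_ hx
  rintro _ ⟨v, hv, rfl⟩
  simp [retraction_raagGen, hTS.notMem_of_mem_right hv]

open Classical in
/-- The subword of letters with vertices in `T`. -/
noncomputable def restrictWord (T : Set V) (l : List (V × Bool)) : List (V × Bool) :=
  l.filter fun c => c.1 ∈ T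

lemma retraction_wordProd (T : Set V) (l : List (V × Bool)) :
    retraction Γ T (wordProd Γ l) = wordProd Γ (restrictWord T l) := by
  induction l with
  | nil => simp [restrictWord]
  | cons a l ih =>
    obtain ⟨v, b⟩ := a
    rw [wordProd_cons, map_mul, ih]
    by_cases hv : v ∈ T
    · have h1 : restrictWord T ((v, b) :: l) = (v, b) :: restrictWord T l := by
        simp [restrictWord, hv]
      rw [h1, wordProd_cons (v, b) (restrictWord T l)]
      cases b <;> simp [wordProd, retraction_raagGen, hv]
    · have h1 : restrictWord T ((v, b) :: l) = restrictWord T l := by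
        simp [restrictWord, hv]
      rw [h1]
      cases b <;> simp [wordProd, retraction_raagGen, hv]

lemma TraceEq.restrictWord {l m : List (V × Bool)} (h : TraceEq Γ l m) (T : Set V) :
    TraceEq Γ (restrictWord T l) (restrictWord T m) := by
  classical
  intro a b hab
  have hcomm : ∀ n, pairProj a b (RightAngledArtin.restrictWord T n) =
      RightAngledArtin.restrictWord T (pairProj a b n) := fun n => List.filter_comm _ _ _
  rw [hcomm, hcomm, h a b hab]

lemma restrictWord_append (T : Set V) (l m : List (V × Bool)) :
    restrictWord T (l ++ m) = restrictWord T l ++ restrictWord T m := by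
  simp [restrictWord]

lemma wordSupp_restrictWord (T : Set V) (l : List (V × Bool)) :
    wordSupp (restrictWord T l) = wordSupp l ∩ T := by
  ext v
  simp [wordSupp, restrictWord]

lemma wordProd_mem_of_forall {K : Subgroup (RAAG Γ)} {l : List (V × Bool)}
    (h : ∀ a ∈ l, raagGen Γ a.1 ∈ K) : wordProd Γ l ∈ K := by
  refine Subgroup.list_prod_mem _ fun x hx => ?_
  obtain ⟨a, ha, rfl⟩ := List.mem_map.1 hx
  split_ifs
  · exact h a ha
  · exact K.inv_mem (h a ha)

lemma list_prod_ofFn_eq_of_forall_ne {G : Type*} [Monoid G] {k : ℕ} (f : Fin k → G) (i : Fin k)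
    (h : ∀ j, j ≠ i → f j = 1) : (List.ofFn f).prod = f i := by
  induction k with
  | zero => exact i.elim0
  | succ k ih =>
    rw [List.ofFn_succ, List.prod_cons]
    cases i using Fin.cases with
    | zero =>
      have : (List.ofFn fun j : Fin k => f j.succ).prod = 1 := by
        refine List.prod_eq_one fun x hx => ?_
        obtain ⟨j, rfl⟩ := List.mem_ofFn.1 hx
        exact h _ (Fin.succ_ne_zero j)
      rw [this, mul_one]
    | succ i =>
      rw [h 0 (Fin.succ_ne_zero i).symm, one_mul]
      exact ih (fun j => f j.succ) i fun j hj => h _ fun h' => hj (Fin.succ_injective _ h')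

/-! ### Join decompositions -/

section Join

variable {S : Set V} {k : ℕ} {Λ : Fin k → Set V}

lemma _root_.IsJoinDecomp.subset (h : IsJoinDecomp Γ S Λ) (i : Fin k) : Λ i ⊆ S :=
  h.2.1 ▸ Set.subset_iUnion Λ i

lemma _root_.IsJoinDecomp.adj_link (h : IsJoinDecomp Γ S Λ) (i : Fin k) :
    ∀ u ∈ Λ i, ∀ v ∈ linkSet Γ S, Γ.Adj u v :=
  fun u hu _ hv => (hv u (h.subset i hu)).symm

lemma _root_.IsJoinDecomp.disjoint_link (h : IsJoinDecomp Γ S Λ) (i : Fin k) :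
    Disjoint (Λ i) (linkSet Γ S) :=
  Set.disjoint_left.2 fun u hu hu' => Γ.loopless.irrefl u (h.adj_link i u hu u hu')

lemma _root_.IsJoinDecomp.retraction_prod (h : IsJoinDecomp Γ S Λ) {c : Fin k → RAAG Γ}
    (hc : ∀ i, c i ∈ standardSubgroup Γ (Λ i)) (i : Fin k) :
    retraction Γ (Λ i) (List.ofFn c).prod = c i := by
  rw [map_list_prod, List.map_ofFn, list_prod_ofFn_eq_of_forall_ne _ i]
  · exact retraction_of_mem (hc i)
  · intro j hj
    exact retraction_eq_one (h.2.2.1 i j hj.symm) (hc j)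

/-- The subgroup generated by a join and its link is the product of the subgroups generated by
the factors: membership in a product of subgroups is decided by the retractions. -/
lemma _root_.IsJoinDecomp.mem_of_retraction_mem (h : IsJoinDecomp Γ S Λ) {y : RAAG Γ}
    (hy : y ∈ standardSubgroup Γ (S ∪ linkSet Γ S)) {K : Fin k → Subgroup (RAAG Γ)}
    (hK : ∀ i, retraction Γ (Λ i) y ∈ K i) :
    y ∈ (⨆ i, K i) ⊔ standardSubgroup Γ (linkSet Γ S) := by
  let H : Option (Fin k) → Subgroup (RAAG Γ) :=
    fun o => o.elim (standardSubgroup Γ (linkSet Γ S)) fun i => standardSubgroup Γ (Λ i)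
  have hcomm : Pairwise fun i j => ∀ x y : RAAG Γ, x ∈ H i → y ∈ H j → Commute x y := by
    rintro (_ | i) (_ | j) hij x y hx hy
    · exact absurd rfl hij
    · exact (commute_of_adj (h.adj_link j) hy hx).symm
    · exact commute_of_adj (h.adj_link i) hx hy
    · exact commute_of_adj (h.2.2.2 i j fun hij' => hij (congrArg some hij')) hx hy
  have hyH : y ∈ ⨆ o, H o := by
    refine (Subgroup.closure_le _).2 ?_ hy
    rintro _ ⟨v, hv | hv, rfl⟩
    · rw [← h.2.1] at hv
      obtain ⟨i, hi⟩ := Set.mem_iUnion.1 hv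
      exact Subgroup.mem_iSup_of_mem (some i) (Subgroup.subset_closure ⟨v, hi, rfl⟩)
    · exact Subgroup.mem_iSup_of_mem none (Subgroup.subset_closure ⟨v, hv, rfl⟩)
  rw [← Subgroup.noncommPiCoprod_range (hcomm := hcomm)] at hyH
  obtain ⟨f, rfl⟩ := hyH
  have hf : ∀ i, retraction Γ (Λ i) (Subgroup.noncommPiCoprod hcomm f) = f (some i) := by
    intro i
    have hhom : (retraction Γ (Λ i)).comp (Subgroup.noncommPiCoprod hcomm) =
        (H (some i)).subtype.comp (Pi.evalMonoidHom _ (some i)) := by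
      refine MonoidHom.pi_ext fun o x => ?_
      simp only [MonoidHom.comp_apply, Subgroup.noncommPiCoprod_mulSingle, Pi.evalMonoidHom_apply,
        Subgroup.subtype_apply]
      by_cases ho : o = some i
      · subst ho
        rw [Pi.mulSingle_eq_same]
        exact retraction_of_mem x.2
      · rw [Pi.mulSingle_eq_of_ne (Ne.symm ho), Subgroup.coe_one]
        rcases o with _ | j
        · exact retraction_eq_one (h.disjoint_link i) x.2
        · exact retraction_eq_one (h.2.2.1 i j fun hij => ho (congrArg some hij.symm)) x.2
    exact DFunLike.congr_fun hhom f
  rw [Subgroup.noncommPiCoprod_apply]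
  refine Subgroup.noncommProd_mem _ _ ?_
  rintro (_ | i) -
  · exact Subgroup.mem_sup_right (f none).2
  · exact Subgroup.mem_sup_left (Subgroup.mem_iSup_of_mem i (hf i ▸ hK i))

end Join

end RightAngledArtin

open RightAngledArtin

/-- Servatius' centraliser theorem: with `g = h w h⁻¹`, `w` cyclically reduced with
support decomposed as a join `Λ₁ ∗ ⋯ ∗ Λ_k` of irreducible subgraphs, `w = w₁ ⋯ w_k`
with `wᵢ ∈ ⟨Λᵢ⟩`, and `gᵢ` a generator of the maximal infinite cyclic subgroup of
`⟨Λᵢ⟩` containing `wᵢ`, the centraliser of `g` is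
`h (⟨g₁⟩ × ⋯ × ⟨g_k⟩ × ⟨link(supp w)⟩) h⁻¹`, the factors generating their internal
direct product. -/
theorem centralizer_raag {V : Type u} [Fintype V] (Γ : SimpleGraph V)
    (g h : RAAG Γ) (w : List (V × Bool)) (hg : g ≠ 1)
    (hred : CyclicallyReduced Γ w) (hgw : g = h * wordProd Γ w * h⁻¹)
    {k : ℕ} (Λ : Fin k → Set V)
    (hjoin : IsJoinDecomp Γ (wordSupp w) Λ)
    (hirr : ∀ i, IrreducibleSet Γ (Λ i))
    (W : Fin k → RAAG Γ)
    (hW : ∀ i, W i ∈ Subgroup.closure (raagGen Γ '' Λ i))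
    (hprod : wordProd Γ w = (List.ofFn W).prod)
    (gi : Fin k → RAAG Γ)
    (hgiMem : ∀ i, gi i ∈ Subgroup.closure (raagGen Γ '' Λ i))
    (hgiInf : ∀ i, (Subgroup.zpowers (gi i) : Set (RAAG Γ)).Infinite)
    (hgiW : ∀ i, W i ∈ Subgroup.zpowers (gi i))
    (hgiMax : ∀ i, ∀ x ∈ Subgroup.closure (raagGen Γ '' Λ i),
      (Subgroup.zpowers x : Set (RAAG Γ)).Infinite → gi i ∈ Subgroup.zpowers x →
        Subgroup.zpowers x = Subgroup.zpowers (gi i)) :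
    Subgroup.centralizer {g} =
      Subgroup.map (MulAut.conj h).toMonoidHom
        ((⨆ i, Subgroup.zpowers (gi i)) ⊔
          Subgroup.closure (raagGen Γ '' linkSet Γ (wordSupp w)))
    ∧ (∀ i j, i ≠ j → Commute (gi i) (gi j))
    ∧ (∀ i, ∀ y ∈ Subgroup.closure (raagGen Γ '' linkSet Γ (wordSupp w)),
        Commute (gi i) y)
    ∧ (∀ (c c' : Fin k → RAAG Γ) (d d' : RAAG Γ),
        (∀ i, c i ∈ Subgroup.zpowers (gi i)) →
        (∀ i, c' i ∈ Subgroup.zpowers (gi i)) →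
        d ∈ Subgroup.closure (raagGen Γ '' linkSet Γ (wordSupp w)) →
        d' ∈ Subgroup.closure (raagGen Γ '' linkSet Γ (wordSupp w)) →
        (List.ofFn c).prod * d = (List.ofFn c').prod * d' → c = c' ∧ d = d') := by
  have hmemH : ∀ i, Subgroup.zpowers (gi i) ≤ standardSubgroup Γ (Λ i) :=
    fun i => Subgroup.zpowers_le.2 (hgiMem i)
  have hcommΛ : ∀ i j, i ≠ j → ∀ {x y}, x ∈ standardSubgroup Γ (Λ i) →
      y ∈ standardSubgroup Γ (Λ j) → Commute x y :=
    fun i j hij _ _ hx hy => commute_of_adj (hjoin.2.2.2 i j hij) hx hy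
  have hcommL : ∀ i, ∀ y ∈ standardSubgroup Γ (linkSet Γ (wordSupp w)), Commute (gi i) y :=
    fun i y hy => commute_of_adj (hjoin.adj_link i) (hgiMem i) hy
  have hcommgi : ∀ i j, i ≠ j → Commute (gi i) (gi j) :=
    fun i j hij => hcommΛ i j hij (hgiMem i) (hgiMem j)
  have hrW : ∀ i, retraction Γ (Λ i) (wordProd Γ w) = W i :=
    fun i => by rw [hprod, hjoin.retraction_prod hW]
  refine ⟨?_, hcommgi, hcommL, ?_⟩
  swap
  · intro c c' d d' hc hc' hd hd' heq
    have hret : ∀ (c : Fin k → RAAG Γ) (d : RAAG Γ), (∀ i, c i ∈ Subgroup.zpowers (gi i)) →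
        d ∈ standardSubgroup Γ (linkSet Γ (wordSupp w)) →
        ∀ i, retraction Γ (Λ i) ((List.ofFn c).prod * d) = c i := by
      intro c d hc hd i
      rw [map_mul, hjoin.retraction_prod (fun i => hmemH i (hc i)),
        retraction_eq_one (hjoin.disjoint_link i) hd, mul_one]
    have hcc : c = c' := by
      ext i
      rw [← hret c d hc hd i, heq, hret c' d' hc' hd' i]
    subst hcc
    exact ⟨rfl, mul_left_cancel heq⟩
  have hwgi : ∀ i, Commute (wordProd Γ w) (gi i) := by
    intro i
    rw [hprod]
    refine Commute.list_prod_left _ _ fun x hx => ?_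
    obtain ⟨j, rfl⟩ := List.mem_ofFn.1 hx
    obtain ⟨t, ht⟩ := Subgroup.mem_zpowers_iff.1 (hgiW j)
    rw [← ht]
    by_cases hij : j = i
    · rw [hij]
      exact (Commute.refl _).zpow_left t
    · exact (hcommgi j i hij).zpow_left t
  have hcyclic : ∀ i, ∀ x ∈ standardSubgroup Γ (Λ i), Commute x (W i) →
      x ∈ Subgroup.zpowers (gi i) := by
    intro i
    let w' := restrictWord (Λ i) w
    have hsupp : wordSupp w' = Λ i := by
      rw [wordSupp_restrictWord, Set.inter_eq_right.2 (hjoin.subset i)]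
    have hw' : wordProd Γ w' = W i := by rw [← retraction_wordProd, hrW]
    let C : Subgroup (RAAG Γ) := standardSubgroup Γ (Λ i) ⊓ Subgroup.centralizer {W i}
    have hCcomm : ∀ x, x ∈ Subgroup.centralizer {W i} ↔ Commute x (W i) := fun x => by
      rw [Subgroup.mem_centralizer_singleton_iff]
      exact Iff.rfl
    have hC : ∀ x ∈ C, ∃ (n : ℕ) (X : List (V × Bool)), wordSupp X ⊆ wordSupp w' ∧
        wordProd Γ X = x * wordProd Γ w' ^ n ∧ TraceEq Γ (X ++ w') (w' ++ X) := by
      rintro x ⟨hx, hxW⟩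
      have hxw : Commute x (wordProd Γ w) := by
        rw [hprod]
        refine Commute.list_prod_right _ _ fun y hy => ?_
        obtain ⟨j, rfl⟩ := List.mem_ofFn.1 hy
        by_cases hij : i = j
        · subst hij
          exact (hCcomm x).1 hxW
        · exact hcommΛ i j hij hx (hW j)
      obtain ⟨n, X, hX, hXw⟩ := exists_traceEq_comm hred hxw
      refine ⟨n, restrictWord (Λ i) X, ?_, ?_, ?_⟩
      · rw [hsupp, wordSupp_restrictWord]
        exact Set.inter_subset_right
      · rw [← retraction_wordProd, hX, map_mul, map_pow, hrW, hw', retraction_of_mem hx]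
      · rw [← restrictWord_append, ← restrictWord_append]
        exact hXw.restrictWord (Λ i)
    have hgC : gi i ∈ C := by
      refine ⟨hgiMem i, (hCcomm _).2 ?_⟩
      obtain ⟨t, ht⟩ := Subgroup.mem_zpowers_iff.1 (hgiW i)
      rw [← ht]
      exact (Commute.refl _).zpow_right t
    have hginf : ¬ IsOfFinOrder (gi i) := infinite_zpowers.1 (hgiInf i)
    have hCcyc : IsCyclic C := by
      refine isCyclic_of_irreducible (w := w') (hsupp ▸ hirr i) (hsupp ▸ hjoin.1 i) C ?_ hC hgC
        (fun n hn h => hginf (isOfFinOrder_iff_pow_eq_one.2 ⟨n, hn, h⟩)) (hw' ▸ hgiW i)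
      rintro x ⟨-, hx⟩
      rw [hw']
      exact (hCcomm x).1 hx
    obtain ⟨c, hc⟩ := hCcyc.exists_generator
    have hCz : ∀ x ∈ C, x ∈ Subgroup.zpowers (c : RAAG Γ) := by
      intro x hx
      obtain ⟨t, ht⟩ := Subgroup.mem_zpowers_iff.1 (hc ⟨x, hx⟩)
      exact ⟨t, congrArg Subtype.val ht⟩
    intro x hx hxW
    rw [← hgiMax i c c.2.1 ((hgiInf i).mono (Subgroup.zpowers_le.2 (hCz _ hgC))) (hCz _ hgC)]
    exact hCz x ⟨hx, (hCcomm x).2 hxW⟩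
  have hcent : ∀ x, Commute x (wordProd Γ w) ↔ x ∈ (⨆ i, Subgroup.zpowers (gi i)) ⊔
      standardSubgroup Γ (linkSet Γ (wordSupp w)) := by
    intro x
    constructor
    · intro hx
      refine hjoin.mem_of_retraction_mem ?_ fun i => hcyclic i _ ?_ ?_
      · obtain ⟨n, X, hX, hXw⟩ := exists_traceEq_comm hred hx
        rw [← mul_inv_eq_iff_eq_mul] at hX
        rw [← hX]
        refine Subgroup.mul_mem _ (wordProd_mem_of_forall fun a ha => ?_)
          (Subgroup.inv_mem _ (Subgroup.pow_mem _ (wordProd_mem_of_forall fun a ha => ?_) n))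
        · exact Subgroup.subset_closure ⟨_, hXw.mem_supp_or_mem_link ha, rfl⟩
        · exact Subgroup.subset_closure ⟨_, Or.inl ⟨a.2, ha⟩, rfl⟩
      · obtain ⟨l, rfl⟩ := exists_wordProd_eq x
        rw [retraction_wordProd]
        refine wordProd_mem_of_forall fun a ha => Subgroup.subset_closure ⟨_, ?_, rfl⟩
        simp only [restrictWord, List.mem_filter, decide_eq_true_eq] at ha
        exact ha.2
      · rw [← hrW i]
        exact hx.map _
    · intro hx
      have hle : (⨆ i, Subgroup.zpowers (gi i)) ⊔ standardSubgroup Γ (linkSet Γ (wordSupp w)) ≤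
          Subgroup.centralizer {wordProd Γ w} := by
        refine sup_le (iSup_le fun i => Subgroup.zpowers_le.2 ?_) fun y hy => ?_
        · exact Subgroup.mem_centralizer_singleton_iff.2 (hwgi i).symm.eq
        · refine Subgroup.mem_centralizer_singleton_iff.2 ?_
          refine (commute_of_adj (A := linkSet Γ (wordSupp w)) (B := wordSupp w)
            (fun u hu v hv => hu v hv) hy (wordProd_mem_of_forall fun a ha => ?_)).eq
          exact Subgroup.subset_closure ⟨_, ⟨a.2, ha⟩, rfl⟩
      exact Subgroup.mem_centralizer_singleton_iff.1 (hle hx)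
  ext x
  rw [Subgroup.mem_centralizer_singleton_iff, Subgroup.mem_map]
  subst hgw
  constructor
  · intro hx
    refine ⟨h⁻¹ * x * h, (hcent _).1 ?_, by simp [mul_assoc]⟩
    have : h⁻¹ * (x * (h * wordProd Γ w * h⁻¹)) * h = h⁻¹ * (h * wordProd Γ w * h⁻¹ * x) * h := by
      rw [hx]
    simpa [Commute, SemiconjBy, mul_assoc] using this
  · rintro ⟨y, hy, rfl⟩
    have := ((hcent y).2 hy).eq
    simp only [MulEquiv.coe_toMonoidHom, MulAut.conj_apply]
    calc h * y * h⁻¹ * (h * wordProd Γ w * h⁻¹) = h * (y * wordProd Γ w) * h⁻¹ := by group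
      _ = h * wordProd Γ w * h⁻¹ * (h * y * h⁻¹) := by rw [this]; group
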